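/- arXiv:2404.02766 — 6 statements merged into one kernel-verified Lean document; each statement's English description precedes it below -/
import Mathlib

section
/- Let A be a commutative ring, let Z be a finite subset of the prime spectrum Spec A, and let V be an open subset of Spec A containing Z. Then V admits a cover by distinguished (basic) open subsets of Spec A each of which contains Z; precisely, for every point v of V there exists an element g of A such that Z ∪ {v} ⊆ D(g) ⊆ V. -/
/-- Prime avoidance on the spectrum: a finite set of primes contained in an open set lies in a
basic open subset of it. -/
theorem PrimeSpectrum.exists_subset_basicOpen_subset_of_finite {A : Type*} [CommRing A]
    {Z V : Set (PrimeSpectrum A)} (hZ : Z.Finite) (hV : IsOpen V) (hZV : Z ⊆ V) :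
    ∃ g : A, Z ⊆ (PrimeSpectrum.basicOpen g : Set (PrimeSpectrum A)) ∧
      (PrimeSpectrum.basicOpen g : Set (PrimeSpectrum A)) ⊆ V := by
  obtain ⟨I, hI⟩ := (PrimeSpectrum.isClosed_iff_zeroLocus_ideal Vᶜ).1 hV.isClosed_compl
  have mem_V (p : PrimeSpectrum A) : p ∈ V ↔ ¬ I ≤ p.asIdeal := by
    rw [← Set.notMem_compl_iff, hI, PrimeSpectrum.mem_zeroLocus, SetLike.coe_subset_coe]
  have hnot : ¬ (I : Set A) ⊆ ⋃ p ∈ Z, (p.asIdeal : Set A) := fun h ↦ by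
    obtain ⟨q, -⟩ : ∃ q, q ∈ Z := by simpa using h I.zero_mem
    obtain ⟨p, hp, hle⟩ := (Ideal.subset_union_prime_finite hZ
      (f := PrimeSpectrum.asIdeal) q q fun p _ _ _ ↦ p.isPrime).1 h
    exact (mem_V p).1 (hZV hp) hle
  obtain ⟨g, hgI, hg⟩ := Set.not_subset.1 hnot
  simp only [Set.mem_iUnion, not_exists] at hg
  exact ⟨g, fun p hp ↦ hg p hp, fun p hp ↦ (mem_V p).2 fun hle ↦ hp (hle hgI)⟩

/-- Let `A` be a commutative ring, `Z` a finite subset of `Spec A`, and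
`V` an open subset of `Spec A` containing `Z`.  Then `V` is covered by distinguished
(basic) open subsets of `Spec A` each containing `Z`: precisely, for every `v ∈ V` there
is `g ∈ A` with `Z ∪ {v} ⊆ D(g) ⊆ V`. -/
theorem distinguished_open_cover_containing_finite_set
    (A : Type*) [CommRing A]
    (Z : Set (PrimeSpectrum A)) (hZfin : Z.Finite)
    (V : Set (PrimeSpectrum A)) (hV : IsOpen V) (hZV : Z ⊆ V) :
    ∀ v ∈ V, ∃ g : A,
      Z ∪ {v} ⊆ (PrimeSpectrum.basicOpen g : Set (PrimeSpectrum A)) ∧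
      (PrimeSpectrum.basicOpen g : Set (PrimeSpectrum A)) ⊆ V := by
  intro v hv
  exact PrimeSpectrum.exists_subset_basicOpen_subset_of_finite
    (hZfin.union (Set.finite_singleton v)) hV (Set.union_subset hZV (Set.singleton_subset_iff.2 hv))
end

section
/- Let K be a field, let A be a commutative K-algebra that is finitely generated as a K-algebra, and let I be an ideal of A such that the quotient A/I is finite-dimensional as a K-vector space. Then every element of A is integral over the subalgebra K[I]; that is, A is an integral extension of K[I]. -/
/-- The `K`-subalgebra `K[I] = {λ·1_A + i : λ ∈ K, i ∈ I}` of `A`. -/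
def kSub (K : Type*) [Field K] (A : Type*) [CommRing A] [Algebra K A]
    (I : Ideal A) : Subalgebra K A where
  carrier := {a : A | ∃ (c : K) (i : A), i ∈ I ∧ a = algebraMap K A c + i}
  mul_mem' := by
    rintro a b ⟨c, i, hi, rfl⟩ ⟨d, j, hj, rfl⟩
    refine ⟨c * d, algebraMap K A c * j + i * algebraMap K A d + i * j,
      I.add_mem (I.add_mem (I.mul_mem_left _ hj) (I.mul_mem_right _ hi)) (I.mul_mem_right _ hi), ?_⟩
    rw [map_mul]; ring
  add_mem' := by
    rintro a b ⟨c, i, hi, rfl⟩ ⟨d, j, hj, rfl⟩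
    exact ⟨c + d, i + j, I.add_mem hi hj, by rw [map_add]; ring⟩
  one_mem' := ⟨1, 0, I.zero_mem, by simp⟩
  zero_mem' := ⟨0, 0, I.zero_mem, by simp⟩
  algebraMap_mem' := fun c => ⟨c, 0, I.zero_mem, by simp⟩

/-- Let `K` be a field, `A` a finitely generated commutative `K`-algebra,
and `I` an ideal of `A` with `A/I` finite-dimensional over `K`.  Then every element of `A`
is integral over the subalgebra `K[I]`. -/
theorem isIntegral_over_kSub
    (K : Type*) [Field K] (A : Type*) [CommRing A] [Algebra K A]
    [Algebra.FiniteType K A]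
    (I : Ideal A) [FiniteDimensional K (A ⧸ I)] :
    ∀ a : A, IsIntegral (kSub K A I) a := by
  intro a
  cases subsingleton_or_nontrivial A
  · exact ⟨1, Polynomial.monic_one, Subsingleton.elim _ _⟩
  obtain ⟨p, hp, hpa⟩ := Algebra.IsIntegral.isIntegral (R := K) (Ideal.Quotient.mk I a)
  have hmem : Polynomial.aeval a (Polynomial.X * p) ∈ I := by
    rw [map_mul]
    refine I.mul_mem_left _ (Ideal.Quotient.eq_zero_iff_mem.mp ?_)
    rw [← Polynomial.aeval_def] at hpa
    rw [← hpa]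
    exact (Polynomial.aeval_algHom_apply (Ideal.Quotient.mkₐ K I) a p).symm
  have hmonic : (Polynomial.X * p).Monic := Polynomial.monic_X.mul hp
  refine IsIntegral.of_aeval_monic (p := (Polynomial.X * p).map (algebraMap K (kSub K A I)))
    (hmonic.map _) ?_ ?_
  · rw [hmonic.natDegree_map, Polynomial.natDegree_X_mul hp.ne_zero]
    exact Nat.succ_ne_zero _
  · rw [Polynomial.aeval_map_algebraMap]
    exact isIntegral_algebraMap (R := kSub K A I) (x := ⟨_, 0, _, hmem, by rw [map_zero, zero_add]; rfl⟩)
end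

section
/- Let K be a field, let A be a commutative K-algebra that is finitely generated as a K-algebra, and let I be an ideal of A such that the quotient A/I is finite-dimensional as a K-vector space. Then A is finitely generated as a module over the subalgebra K[I], and K[I] is finitely generated as a K-algebra. -/
theorem mem_kSub_of_mem {K : Type*} [Field K] {A : Type*} [CommRing A] [Algebra K A]
    {I : Ideal A} {a : A} (ha : a ∈ I) : a ∈ kSub K A I :=
  ⟨0, a, ha, by simp⟩

/-- Lifts of `K`-module generators of `A ⧸ I`, together with `1`, generate `A` over `K[I]`. -/
theorem finite_over_kSub (K : Type*) [Field K] (A : Type*) [CommRing A] [Algebra K A]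
    (I : Ideal A) [FiniteDimensional K (A ⧸ I)] : Module.Finite (kSub K A I) A := by
  obtain ⟨n, s, hs⟩ := Module.Finite.exists_fin (R := K) (M := A ⧸ I)
  choose b hb using fun j => Ideal.Quotient.mk_surjective (s j)
  refine ⟨Submodule.fg_def.2 ⟨insert 1 (Set.range b), (Set.finite_range b).insert 1, ?_⟩⟩
  refine Submodule.eq_top_iff'.2 fun a => ?_
  have ha : Ideal.Quotient.mk I a ∈ Submodule.span K (Set.range s) := hs ▸ Submodule.mem_top
  obtain ⟨c, hc⟩ := (Submodule.mem_span_range_iff_exists_fun K).1 ha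
  have hI : a - ∑ j, c j • b j ∈ I := by
    rw [← Ideal.Quotient.eq, ← hc, map_sum]
    refine Finset.sum_congr rfl fun j _ => ?_
    rw [← hb j]
    exact (map_smul (Ideal.Quotient.mkₐ K I) (c j) (b j)).symm
  rw [← sub_add_cancel a (∑ j, c j • b j)]
  refine Submodule.add_mem _ ?_ (Submodule.sum_mem _ fun j _ => ?_)
  · simpa [Subalgebra.smul_def] using
      Submodule.smul_mem _ (⟨_, mem_kSub_of_mem hI⟩ : kSub K A I)
        (Submodule.subset_span (Set.mem_insert (1 : A) (Set.range b)))
  · exact Submodule.smul_of_tower_mem _ (c j)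
      (Submodule.subset_span (Set.mem_insert_of_mem _ (Set.mem_range_self j)))

/-- Let `K` be a field, `A` a finitely generated commutative `K`-algebra,
and `I` an ideal of `A` with `A/I` finite-dimensional over `K`.  Then `A` is a finitely
generated module over `K[I]`, and `K[I]` is a finitely generated `K`-algebra. -/
theorem finite_over_kSub_and_kSub_finiteType
    (K : Type*) [Field K] (A : Type*) [CommRing A] [Algebra K A]
    [Algebra.FiniteType K A]
    (I : Ideal A) [FiniteDimensional K (A ⧸ I)] :
    Module.Finite (kSub K A I) A ∧ Algebra.FiniteType K (kSub K A I) := by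
  have hfin := finite_over_kSub K A I
  exact ⟨hfin, ⟨fg_of_fg_of_fg K (kSub K A I) A Algebra.FiniteType.out hfin.fg_top
    Subtype.val_injective⟩⟩
end

section
/- Let K be a field, let A be a commutative K-algebra, let I be an ideal of A, let B := K[I], and let g ∈ I (so in particular g ∈ B). Then the ring homomorphism between localizations B_g → A_g induced by the inclusion B ⊆ A (inverting g on both sides) is bijective. -/
/-- An injective ring homomorphism `f : B → A` whose image contains the ideal generated by `f x`
becomes bijective after inverting `x`. -/
theorem IsLocalization.Away.map_bijective_of_injective_of_exists_eq_mul
    {B A Bx Ax : Type*} [CommRing B] [CommRing A] [CommRing Bx] [CommRing Ax]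
    [Algebra B Bx] [Algebra A Ax] (f : B →+* A) (x : B)
    [IsLocalization.Away x Bx] [hS : IsLocalization.Away (f x) Ax]
    (hf : Function.Injective f) (hx : ∀ a, ∃ b, f b = f x * a) :
    Function.Bijective (IsLocalization.Away.map Bx Ax f x) := by
  constructor
  · rw [injective_iff_map_eq_zero]
    intro z hz
    obtain ⟨b, s, rfl⟩ := IsLocalization.exists_mk'_eq (Submonoid.powers x) z
    rw [IsLocalization.Away.map, IsLocalization.map_mk', IsLocalization.mk'_eq_zero_iff] at hz
    obtain ⟨⟨_, n, rfl⟩, hn⟩ := hz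
    exact (IsLocalization.mk'_eq_zero_iff b s).2 ⟨⟨x ^ n, n, rfl⟩, hf (by simpa using hn)⟩
  · intro y
    obtain ⟨a, ⟨_, n, rfl⟩, rfl⟩ := IsLocalization.exists_mk'_eq (Submonoid.powers (f x)) y
    obtain ⟨b, hb⟩ := hx a
    refine ⟨IsLocalization.mk' _ b
      (⟨x ^ (n + 1), n + 1, rfl⟩ : Submonoid.powers x), ?_⟩
    rw [IsLocalization.Away.map, IsLocalization.map_mk', IsLocalization.mk'_eq_iff_eq]
    congr 1
    simp only [hb, map_pow]
    ring

/-- Let `K` be a field, `A` a commutative `K`-algebra, `I` an ideal of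
`A`, `B := K[I]`, and `g ∈ I` (so `g ∈ B`).  Then the ring homomorphism `B_g → A_g`
between the localizations away from `g`, induced by the inclusion `B ⊆ A`, is bijective. -/
theorem localization_away_map_bijective
    (K : Type*) [Field K] (A : Type*) [CommRing A] [Algebra K A]
    (I : Ideal A) (g : A) (hg : g ∈ I) (hgB : g ∈ kSub K A I) :
    Function.Bijective
      (@IsLocalization.Away.map (kSub K A I) _
        (Localization.Away (⟨g, hgB⟩ : kSub K A I)) _ _ A _
        (Localization.Away g) _ _
        ((kSub K A I).val : kSub K A I →+* A) (⟨g, hgB⟩ : kSub K A I) _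
        (inferInstance : IsLocalization.Away g (Localization.Away g))) := by
  refine IsLocalization.Away.map_bijective_of_injective_of_exists_eq_mul
    (hS := inferInstanceAs (IsLocalization.Away g (Localization.Away g)))
    ((kSub K A I).val : kSub K A I →+* A) ⟨g, hgB⟩ Subtype.val_injective fun a => ?_
  exact ⟨⟨g * a, 0, g * a, I.mul_mem_right a hg, by simp⟩, rfl⟩
end

section
/- Let K be a field and let K[X] be the polynomial ring in one variable over K. Then the K-subalgebra of K[X] generated by the two elements X² − X and X³ − X² equals K + (X² − X); that is, a polynomial F ∈ K[X] lies in the subalgebra generated over K by X² − X and X³ − X² if and only if F = c + G for some constant c ∈ K and some G in the principal ideal of K[X] generated by X² − X. -/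
open Polynomial

/-- The subalgebra generated by `X² − X` and `X³ − X²` contains every multiple of `X² − X`. -/
theorem mul_mem_adjoin_nodal {R : Type*} [CommRing R] (H : R[X]) :
    (X ^ 2 - X) * H ∈ Algebra.adjoin R ({X ^ 2 - X, X ^ 3 - X ^ 2} : Set R[X]) := by
  set A := Algebra.adjoin R ({X ^ 2 - X, X ^ 3 - X ^ 2} : Set R[X])
  have hu : (X ^ 2 - X : R[X]) ∈ A := Algebra.subset_adjoin (by simp)
  have hv : (X ^ 3 - X ^ 2 : R[X]) ∈ A := Algebra.subset_adjoin (by simp)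
  have hpow (n : ℕ) : (X ^ 2 - X) * X ^ n ∈ A ∧ (X ^ 2 - X) * X ^ (n + 1) ∈ A := by
    induction n with
    | zero =>
      refine ⟨by simpa using hu, ?_⟩
      convert hv using 1
      ring
    | succ n ih =>
      refine ⟨ih.2, ?_⟩
      convert A.add_mem (A.mul_mem ih.1 hu) ih.2 using 1
      ring
  induction H using Polynomial.induction_on' with
  | add p q hp hq =>
    rw [mul_add]
    exact A.add_mem hp hq
  | monomial n a =>
    rw [← smul_X_eq_monomial, mul_smul_comm]
    exact A.smul_mem (hpow n).1 a

/-- Over a field `K`, the `K`-subalgebra of `K[X]` generated by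
`X² − X` and `X³ − X²` equals `K + (X² − X)`: a polynomial `F` lies in it iff
`F = c + G` for some constant `c ∈ K` and some `G` in the ideal generated by `X² − X`. -/
theorem adjoin_nodal_eq_constants_add_ideal
    (K : Type*) [Field K] (F : K[X]) :
    F ∈ Algebra.adjoin K ({X ^ 2 - X, X ^ 3 - X ^ 2} : Set K[X]) ↔
      ∃ (c : K) (G : K[X]), G ∈ Ideal.span ({X ^ 2 - X} : Set K[X]) ∧ F = C c + G := by
  simp only [Ideal.mem_span_singleton]
  constructor
  · intro hF
    induction hF using Algebra.adjoin_induction with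
    | mem x hx =>
      refine ⟨0, x, ?_, by simp⟩
      rcases hx with rfl | rfl
      · exact dvd_rfl
      · exact ⟨X, by ring⟩
    | algebraMap r => exact ⟨r, 0, dvd_zero _, by simp [algebraMap_eq]⟩
    | add x y _ _ hx hy =>
      obtain ⟨c, G, hG, rfl⟩ := hx
      obtain ⟨d, H, hH, rfl⟩ := hy
      exact ⟨c + d, G + H, dvd_add hG hH, by rw [C_add]; ring⟩
    | mul x y _ _ hx hy =>
      obtain ⟨c, G, hG, rfl⟩ := hx
      obtain ⟨d, H, hH, rfl⟩ := hy
      exact ⟨c * d, G * (C d + H) + C c * H,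
        dvd_add (hG.mul_right _) (hH.mul_left _), by rw [C_mul]; ring⟩
  · rintro ⟨c, _, ⟨H, rfl⟩, rfl⟩
    exact add_mem (Subalgebra.algebraMap_mem _ c) (mul_mem_adjoin_nodal H)
end

section
/- Let K be a field. The kernel of the K-algebra homomorphism K[x, y] → K[t] from the polynomial ring in two variables to the polynomial ring in one variable determined by x ↦ t² − t and y ↦ t³ − t² is the principal ideal of K[x, y] generated by y² − x·y − x³. In particular, the induced map K[x, y]/(y² − xy − x³) → K[t] is injective. -/
namespace NodalCubic

open Polynomial in
/-- Polynomials in `t² − t` are linearly independent from `t³ − t²` times such polynomials: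
the former have even degree and the latter have odd degree. -/
theorem eq_zero_of_comp_add_mul_comp_eq_zero {K : Type*} [Field K] {A B : K[X]}
    (h : A.comp (X ^ 2 - X) + (X ^ 3 - X ^ 2) * B.comp (X ^ 2 - X) = 0) : A = 0 ∧ B = 0 := by
  have h_two : (X ^ 2 - X : K[X]).natDegree = 2 := by compute_degree!
  have h_three : (X ^ 3 - X ^ 2 : K[X]).natDegree = 3 := by compute_degree!
  have comp_ne {P : K[X]} (hP : P ≠ 0) : P.comp (X ^ 2 - X) ≠ 0 := by
    intro h_comp
    rcases comp_eq_zero_iff.mp h_comp with h_zero | ⟨-, h_const⟩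
    · exact hP h_zero
    · have h_deg := congrArg natDegree h_const
      rw [h_two, natDegree_C] at h_deg
      omega
  have h_ne : (X ^ 3 - X ^ 2 : K[X]) ≠ 0 := by
    intro h_zero
    rw [h_zero, natDegree_zero] at h_three
    omega
  have hB : B = 0 := by
    by_contra hB
    have h_deg := congrArg natDegree (eq_neg_of_add_eq_zero_left h)
    rw [natDegree_neg, natDegree_mul h_ne (comp_ne hB), natDegree_comp, natDegree_comp, h_two,
      h_three] at h_deg
    omega
  refine ⟨?_, hB⟩
  by_contra hA
  exact comp_ne hA (by simpa [hB] using h)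

open MvPolynomial in
/-- Modulo the equation of the nodal cubic, every polynomial in `x` and `y` is of the form
`A(x) + y B(x)`. -/
theorem exists_sub_mem_span {R : Type*} [CommRing R] (p : MvPolynomial (Fin 2) R) :
    ∃ A B : Polynomial R,
      p - (Polynomial.aeval (X 0) A + X 1 * Polynomial.aeval (X 0) B) ∈
        Ideal.span {(X 1 ^ 2 - X 0 * X 1 - X 0 ^ 3 : MvPolynomial (Fin 2) R)} := by
  simp only [Ideal.mem_span_singleton]
  induction p using MvPolynomial.induction_on with
  | C a => exact ⟨Polynomial.C a, 0, by simp [MvPolynomial.algebraMap_eq]⟩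
  | add p q hp hq =>
    obtain ⟨A, B, c, hc⟩ := hp
    obtain ⟨A', B', c', hc'⟩ := hq
    refine ⟨A + A', B + B', c + c', ?_⟩
    simp only [map_add]
    linear_combination hc + hc'
  | mul_X p i hp =>
    obtain ⟨A, B, c, hc⟩ := hp
    fin_cases i
    · refine ⟨Polynomial.X * A, Polynomial.X * B, X 0 * c, ?_⟩
      simp only [map_mul, Polynomial.aeval_X, Fin.zero_eta]
      linear_combination X 0 * hc
    · refine ⟨Polynomial.X ^ 3 * B, A + Polynomial.X * B,
        X 1 * c + Polynomial.aeval (X 0) B, ?_⟩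
      simp only [map_add, map_mul, map_pow, Polynomial.aeval_X, Fin.mk_one]
      linear_combination X 1 * hc

end NodalCubic


/-- Over a field `K`, the kernel of the `K`-algebra homomorphism
`K[x, y] → K[t]` determined by `x ↦ t² − t`, `y ↦ t³ − t²` is the principal ideal
generated by `y² − x·y − x³`.  (Hence the induced map
`K[x, y]/(y² − xy − x³) → K[t]` is injective.) -/
theorem ker_nodal_parametrization
    (K : Type*) [Field K] :
    RingHom.ker (MvPolynomial.aeval
        ![Polynomial.X ^ 2 - Polynomial.X, Polynomial.X ^ 3 - Polynomial.X ^ 2] :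
        MvPolynomial (Fin 2) K →ₐ[K] Polynomial K) =
      Ideal.span {(MvPolynomial.X 1) ^ 2 - MvPolynomial.X 0 * MvPolynomial.X 1 -
        (MvPolynomial.X 0) ^ 3} := by
  apply le_antisymm
  · intro p hp
    obtain ⟨A, B, h⟩ := NodalCubic.exists_sub_mem_span p
    obtain ⟨c, hc⟩ := Ideal.mem_span_singleton.mp h
    rw [RingHom.mem_ker] at hp
    have h_image := congrArg (MvPolynomial.aeval
      ![Polynomial.X ^ 2 - Polynomial.X, Polynomial.X ^ 3 - Polynomial.X ^ 2] :
        MvPolynomial (Fin 2) K →ₐ[K] Polynomial K) hc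
    simp only [map_sub, map_add, map_mul, map_pow, hp, ← Polynomial.aeval_algHom_apply,
      MvPolynomial.aeval_X, Matrix.cons_val_zero, Matrix.cons_val_one,
      ← Polynomial.comp_eq_aeval] at h_image
    obtain ⟨rfl, rfl⟩ :=
      NodalCubic.eq_zero_of_comp_add_mul_comp_eq_zero (A := A) (B := B)
        (by linear_combination -h_image)
    simpa using h
  · rw [Ideal.span_singleton_le_iff_mem, RingHom.mem_ker]
    simp only [map_sub, map_mul, map_pow, MvPolynomial.aeval_X, Matrix.cons_val_zero,
      Matrix.cons_val_one]
    ring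
end
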